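/- Let G_n be graphs, d_n ≫ 1, β_n ≪ d_n, and δ̃_n with (max(β_n,1)/d_n)^{1/2} ≤ O(δ̃_n) ≪ 1. Let c_{β_n} := {exp(−β_n U_e)}_{e∈E(G_n)} with i.i.d. Unif[0,1] labels U_e, and μ_n := (1−e^{−β_n})/β_n. (a) If |{v ∈ V(G_n) : deg(v) ≥ d_n}| ≥ (1−δ̃_n)|V(G_n)|, then with probability 1 − o(δ̃_n), the network (G_n, c_{β_n}) satisfies Assumption (EO) with γ_n := μ_n d_n/2 and δ_n := 2δ̃_n. (b) If (G_n, 1) satisfies Assumption (LL) with parameters K̃, γ_n = d_n and δ̃_n, then with probability 1 − o(δ̃_n), the network (G_n, c_{β_n}) satisfies Assumption (LL) with γ_n := μ_n d_n/2, K := 2K̃+1 and δ_n := (2K̃+3)δ̃_n. -/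

import Mathlib

open MeasureTheory Filter Finset

noncomputable section

set_option linter.unusedSectionVars false

namespace WSTPaper

variable {V : Type} [Fintype V] [DecidableEq V]

/-- The conductance `C_v = Σ_{u ~ v} c(u,v)` of a vertex in the electric network `(G, c)`. -/
def vertCond (G : SimpleGraph V) [DecidableRel G.Adj] (c : Sym2 V → ℝ) (v : V) : ℝ :=
  ∑ u ∈ G.neighborFinset v, c s(u, v)

/-- Product of i.i.d. Uniform[0,1] label measures. -/
def labelMeasure (ι : Type) [Fintype ι] : Measure (ι → ℝ) :=
  Measure.pi fun _ => (volume.restrict (Set.Icc (0:ℝ) 1))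

/-- `μ_β = E[e^{-βU}]` for `U ~ Uniform[0,1]`. -/
def muBeta (β : ℝ) : ℝ := ∫ x in Set.Icc (0:ℝ) 1, Real.exp (-β * x)

open scoped Classical

/-- The conditions of Assumption (EO) at a single `n`, for the network `(G, c)` with
parameters `γ, δ`: (i) at least `(1-δ)|V|` vertices have `C_v ≥ γ`; (ii) `c(e) ≤ δγ`
for every edge. -/
def EOCondAt (G : SimpleGraph V) [DecidableRel G.Adj] (c : Sym2 V → ℝ) (γ δ : ℝ) : Prop :=
  ((((Finset.univ.filter fun v : V => γ ≤ vertCond G c v).card : ℝ))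
      ≥ (1 - δ) * (Fintype.card V : ℝ)) ∧
  (∀ e ∈ G.edgeSet, c e ≤ δ * γ)

/-- The conditions of Assumption (LL) at a single `n`, for the network `(G, c)` with
parameters `γ, K, δ`: (i) at least `(1-δ)|V|` vertices have `C_v ∈ [γ, Kγ]`;
(ii) `Σ_{v ∉ W^{(tc)}} C_v ≤ δγ|V|`; (iii) `c(e) ≤ δγ` for every edge. -/
def LLCondAt (G : SimpleGraph V) [DecidableRel G.Adj] (c : Sym2 V → ℝ) (γ K δ : ℝ) : Prop :=
  ((((Finset.univ.filter fun v : V =>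
        vertCond G c v ∈ Set.Icc γ (K * γ)).card : ℝ))
      ≥ (1 - δ) * (Fintype.card V : ℝ)) ∧
  ((∑ v ∈ Finset.univ.filter (fun v : V => vertCond G c v ∉ Set.Icc γ (K * γ)),
      vertCond G c v) ≤ δ * γ * (Fintype.card V : ℝ)) ∧
  (∀ e ∈ G.edgeSet, c e ≤ δ * γ)

instance isProbabilityMeasure_labelMeasure (ι : Type) [Fintype ι] :
    IsProbabilityMeasure (labelMeasure ι) := by
  have : IsProbabilityMeasure (volume.restrict (Set.Icc (0:ℝ) 1)) := ⟨by simp⟩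
  unfold labelMeasure
  infer_instance

lemma ae_labelMeasure_mem_Icc (ι : Type) [Fintype ι] :
    ∀ᵐ u ∂labelMeasure ι, ∀ i, u i ∈ Set.Icc (0:ℝ) 1 := by
  rw [ae_all_iff]
  intro i
  have : IsProbabilityMeasure (volume.restrict (Set.Icc (0:ℝ) 1)) := ⟨by simp⟩
  exact (Measure.tendsto_eval_ae_ae (μ := fun _ : ι => volume.restrict (Set.Icc (0:ℝ) 1))
    (i := i)).eventually (ae_restrict_mem measurableSet_Icc)

lemma integrableOn_exp_neg_mul (β : ℝ) :
    IntegrableOn (fun x => Real.exp (-β * x)) (Set.Icc 0 1) :=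
  Continuous.integrableOn_Icc (by fun_prop)

lemma exp_neg_one_le_muBeta_mul {β : ℝ} : Real.exp (-1) ≤ muBeta β * max β 1 := by
  have hm : 0 < max β 1 := lt_max_of_lt_right one_pos
  have hsub : Set.Icc 0 (max β 1)⁻¹ ⊆ Set.Icc (0:ℝ) 1 :=
    Set.Icc_subset_Icc_right (inv_le_one_of_one_le₀ (le_max_right _ _))
  have hconst : ∫ _ in Set.Icc (0:ℝ) (max β 1)⁻¹, Real.exp (-1) =
      (max β 1)⁻¹ * Real.exp (-1) := by
    rw [setIntegral_const, Real.volume_real_Icc_of_le (inv_nonneg.2 hm.le), sub_zero, smul_eq_mul]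
  have hle : (max β 1)⁻¹ * Real.exp (-1) ≤ muBeta β := by
    rw [← hconst]
    calc ∫ _ in Set.Icc (0:ℝ) (max β 1)⁻¹, Real.exp (-1)
        ≤ ∫ x in Set.Icc (0:ℝ) (max β 1)⁻¹, Real.exp (-β * x) := by
          refine setIntegral_mono_on (continuousOn_const.integrableOn_Icc)
            ((integrableOn_exp_neg_mul β).mono_set hsub) measurableSet_Icc fun x hx => ?_
          apply Real.exp_le_exp.2
          have h1 : β * x ≤ max β 1 * (max β 1)⁻¹ :=
            mul_le_mul (le_max_left _ _) hx.2 hx.1 hm.le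
          rw [mul_inv_cancel₀ hm.ne'] at h1
          linarith
      _ ≤ muBeta β := setIntegral_mono_set (integrableOn_exp_neg_mul β)
          (ae_of_all _ fun x => (Real.exp_pos _).le) hsub.eventuallyLE
  calc Real.exp (-1) = (max β 1)⁻¹ * Real.exp (-1) * max β 1 := by field_simp
    _ ≤ _ := by gcongr

lemma muBeta_pos (β : ℝ) : 0 < muBeta β := by
  have h := (Real.exp_pos (-1)).trans_le (exp_neg_one_le_muBeta_mul (β := β))
  exact pos_of_mul_pos_left h (le_max_of_le_right zero_le_one)

lemma integral_exp_mul_exp_le {β : ℝ} (hβ : 0 ≤ β) {a : ℝ} (ha : |a| ≤ 1) :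
    ∫ x in Set.Icc (0:ℝ) 1, Real.exp (a * Real.exp (-β * x)) ≤
      Real.exp (muBeta β * (a + a ^ 2)) := by
  calc ∫ x in Set.Icc (0:ℝ) 1, Real.exp (a * Real.exp (-β * x))
      ≤ ∫ x in Set.Icc (0:ℝ) 1, (1 + Real.exp (-β * x) * (a + a ^ 2)) := by
        refine setIntegral_mono_on (Continuous.integrableOn_Icc (by fun_prop))
          (Continuous.integrableOn_Icc (by fun_prop)) measurableSet_Icc fun x hx => ?_
        have h0 := Real.exp_pos (-β * x)
        have h1 : Real.exp (-β * x) ≤ 1 := Real.exp_le_one_iff.2 (by nlinarith [hx.1])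
        have h2 : |a * Real.exp (-β * x)| ≤ 1 := by
          rw [abs_mul, abs_of_pos h0]
          exact mul_le_one₀ ha h0.le h1
        have h3 := (abs_le.1 (Real.abs_exp_sub_one_sub_id_le h2)).2
        nlinarith [mul_nonneg (sq_nonneg a) (mul_nonneg h0.le (sub_nonneg.2 h1))]
    _ = muBeta β * (a + a ^ 2) + 1 := by
        rw [integral_add (continuousOn_const.integrableOn_Icc)
          ((integrableOn_exp_neg_mul β).mul_const _), integral_mul_const]
        simp [muBeta, add_comm]
    _ ≤ _ := Real.add_one_le_exp _

lemma integrable_exp_sum_mul {ι : Type} [Fintype ι] (β : ℝ) (a : ι → ℝ) :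
    Integrable (fun u : ι → ℝ => Real.exp (∑ e, a e * Real.exp (-β * u e)))
      (labelMeasure ι) := by
  simp_rw [Real.exp_sum]
  exact Integrable.fintype_prod (f := fun e x => Real.exp (a e * Real.exp (-β * x)))
    fun e => Continuous.integrableOn_Icc (by fun_prop)

lemma integral_exp_sum_mul_le {ι : Type} [Fintype ι] {β : ℝ} (hβ : 0 ≤ β) {a : ι → ℝ}
    (ha : ∀ e, |a e| ≤ 1) :
    ∫ u, Real.exp (∑ e, a e * Real.exp (-β * u e)) ∂labelMeasure ι ≤
      Real.exp (muBeta β * ∑ e, (a e + a e ^ 2)) := by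
  simp_rw [Real.exp_sum]
  unfold labelMeasure
  rw [integral_fintype_prod_eq_prod (f := fun e x => Real.exp (a e * Real.exp (-β * x))),
    Finset.mul_sum, Real.exp_sum]
  exact Finset.prod_le_prod (fun e _ => integral_nonneg fun x => (Real.exp_pos _).le)
    fun e _ => integral_exp_mul_exp_le hβ (ha e)

/-- The number of endpoints in `B` of an edge `e` of `G`. -/
def endpointCount (G : SimpleGraph V) [DecidableRel G.Adj] (B : Finset V) (e : Sym2 V) : ℝ :=
  ∑ v ∈ B, ∑ u ∈ G.neighborFinset v, if e = s(u, v) then 1 else 0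

lemma sum_vertCond_eq (G : SimpleGraph V) [DecidableRel G.Adj] (B : Finset V)
    (c : Sym2 V → ℝ) : ∑ v ∈ B, vertCond G c v = ∑ e, endpointCount G B e * c e := by
  simp only [endpointCount, vertCond, Finset.sum_mul]
  rw [Finset.sum_comm]
  refine Finset.sum_congr rfl fun v _ => ?_
  rw [Finset.sum_comm]
  exact Finset.sum_congr rfl fun u _ => by simp

lemma vertCond_one (G : SimpleGraph V) [DecidableRel G.Adj] (v : V) :
    vertCond G (fun _ => 1) v = G.degree v := by
  simp [vertCond]

lemma sum_endpointCount (G : SimpleGraph V) [DecidableRel G.Adj] (B : Finset V) :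
    ∑ e, endpointCount G B e = ∑ v ∈ B, (G.degree v : ℝ) := by
  simpa [vertCond_one] using (sum_vertCond_eq G B fun _ => 1).symm

lemma endpointCount_nonneg (G : SimpleGraph V) [DecidableRel G.Adj] (B : Finset V)
    (e : Sym2 V) : 0 ≤ endpointCount G B e :=
  Finset.sum_nonneg fun _ _ => Finset.sum_nonneg fun _ _ => by positivity

lemma endpointCount_le_two (G : SimpleGraph V) [DecidableRel G.Adj] (B : Finset V)
    (e : Sym2 V) : endpointCount G B e ≤ 2 := by
  induction e with
  | _ a b =>
    calc endpointCount G B s(a, b)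
        ≤ ∑ v : V, ∑ u : V, if s(a, b) = s(u, v) then (1:ℝ) else 0 :=
          (Finset.sum_le_sum fun v _ => Finset.sum_le_sum_of_subset_of_nonneg
            (Finset.subset_univ _) fun _ _ _ => by positivity).trans
          (Finset.sum_le_sum_of_subset_of_nonneg (Finset.subset_univ _)
            fun _ _ _ => Finset.sum_nonneg fun _ _ => by positivity)
      _ ≤ ∑ v : V, ∑ u : V, ((if a = u then (if b = v then (1:ℝ) else 0) else 0) +
            (if b = u then (if a = v then (1:ℝ) else 0) else 0)) := by
          refine Finset.sum_le_sum fun v _ => Finset.sum_le_sum fun u _ => ?_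
          simp only [Sym2.eq_iff]
          split_ifs <;> norm_num <;> tauto
      _ = 2 := by
          simp only [Finset.sum_add_distrib, Finset.sum_ite_eq, Finset.mem_univ, if_true]
          norm_num

lemma integrable_exp_mul_sum_vertCond (G : SimpleGraph V) [DecidableRel G.Adj] (B : Finset V)
    (β l : ℝ) :
    Integrable (fun u : Sym2 V → ℝ =>
        Real.exp (l * ∑ v ∈ B, vertCond G (fun e => Real.exp (-β * u e)) v))
      (labelMeasure (Sym2 V)) := by
  simp_rw [sum_vertCond_eq, Finset.mul_sum, ← mul_assoc]
  exact integrable_exp_sum_mul β _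

lemma integral_exp_mul_sum_vertCond_le (G : SimpleGraph V) [DecidableRel G.Adj] (B : Finset V)
    {β l : ℝ} (hβ : 0 ≤ β) (hl : |l| ≤ 1 / 2) :
    ∫ u, Real.exp (l * ∑ v ∈ B, vertCond G (fun e => Real.exp (-β * u e)) v)
        ∂labelMeasure (Sym2 V) ≤
      Real.exp (muBeta β * ((l + 2 * l ^ 2) * ∑ v ∈ B, (G.degree v : ℝ))) := by
  simp_rw [sum_vertCond_eq, Finset.mul_sum, ← mul_assoc]
  refine (integral_exp_sum_mul_le hβ fun e => ?_).trans (Real.exp_le_exp.2 ?_)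
  · rw [abs_mul, abs_of_nonneg (endpointCount_nonneg G B e)]
    nlinarith [endpointCount_nonneg G B e, endpointCount_le_two G B e, abs_nonneg l]
  · calc _ ≤ muBeta β * ((l + 2 * l ^ 2) * ∑ v ∈ B, (G.degree v : ℝ)) := by
          rw [← sum_endpointCount, Finset.mul_sum (a := l + 2 * l ^ 2)]
          refine mul_le_mul_of_nonneg_left (Finset.sum_le_sum fun e _ => ?_) (muBeta_pos β).le
          nlinarith [mul_nonneg (sq_nonneg l) (mul_nonneg (endpointCount_nonneg G B e)
            (sub_nonneg.2 (endpointCount_le_two G B e)))]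
      _ = _ := by simp only [Finset.mul_sum, mul_assoc]

lemma integrable_exp_mul_vertCond (G : SimpleGraph V) [DecidableRel G.Adj] (v : V) (β l t : ℝ) :
    Integrable (fun u : Sym2 V → ℝ =>
        Real.exp (l * (vertCond G (fun e => Real.exp (-β * u e)) v - t)))
      (labelMeasure (Sym2 V)) := by
  have h := (integrable_exp_mul_sum_vertCond G {v} β l).mul_const (Real.exp (-(l * t)))
  simpa only [Finset.sum_singleton, ← Real.exp_add, mul_add, mul_neg, sub_eq_add_neg] using h

lemma integral_exp_mul_vertCond_le (G : SimpleGraph V) [DecidableRel G.Adj] (v : V)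
    {β l : ℝ} (t : ℝ) (hβ : 0 ≤ β) (hl : |l| ≤ 1 / 2) :
    ∫ u, Real.exp (l * (vertCond G (fun e => Real.exp (-β * u e)) v - t))
        ∂labelMeasure (Sym2 V) ≤
      Real.exp (muBeta β * ((l + 2 * l ^ 2) * G.degree v) - l * t) := by
  have h := integral_exp_mul_sum_vertCond_le G {v} hβ hl
  simp only [Finset.sum_singleton] at h
  simp_rw [mul_sub, sub_eq_add_neg, Real.exp_add]
  rw [integral_mul_const]
  gcongr

lemma integral_lower_tail_le (G : SimpleGraph V) [DecidableRel G.Adj] {v : V} {β d : ℝ}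
    (hβ : 0 ≤ β) (hv : d ≤ G.degree v) :
    ∫ u, Real.exp (-(1 / 8) * (vertCond G (fun e => Real.exp (-β * u e)) v - muBeta β * d / 2))
        ∂labelMeasure (Sym2 V) ≤ Real.exp (-(muBeta β * d) / 32) := by
  refine (integral_exp_mul_vertCond_le G v _ hβ (by norm_num [abs_le])).trans
    (Real.exp_le_exp.2 ?_)
  nlinarith [mul_le_mul_of_nonneg_left hv (muBeta_pos β).le]

lemma integral_upper_tail_le (G : SimpleGraph V) [DecidableRel G.Adj] {v : V} {β d K : ℝ}
    (hβ : 0 ≤ β) (hK : 1 < K) (hv : (G.degree v : ℝ) ≤ K * d) :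
    ∫ u, Real.exp (1 / (8 * K) * (vertCond G (fun e => Real.exp (-β * u e)) v -
        (K + 1 / 2) * (muBeta β * d))) ∂labelMeasure (Sym2 V) ≤
      Real.exp (-(muBeta β * d) / (32 * K)) := by
  have hK0 : 0 < K := by linarith
  have hl : 1 / (8 * K) ≤ 1 / 2 := by
    apply one_div_le_one_div_of_le <;> linarith
  refine (integral_exp_mul_vertCond_le G v _ hβ ?_).trans (Real.exp_le_exp.2 ?_)
  · rwa [abs_of_nonneg (by positivity)]
  · calc muBeta β * ((1 / (8 * K) + 2 * (1 / (8 * K)) ^ 2) * G.degree v)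
          - 1 / (8 * K) * ((K + 1 / 2) * (muBeta β * d))
        ≤ muBeta β * ((1 / (8 * K) + 2 * (1 / (8 * K)) ^ 2) * (K * d))
          - 1 / (8 * K) * ((K + 1 / 2) * (muBeta β * d)) := by
          have := (muBeta_pos β).le
          gcongr
      _ = -(muBeta β * d) / (32 * K) := by
          field_simp
          ring

lemma measureReal_le_of_ae_imp {Ω : Type*} [MeasurableSpace Ω] {P : Measure Ω}
    [IsProbabilityMeasure P] {s t : Set Ω} (h : ∀ᵐ ω ∂P, ω ∈ s → ω ∈ t) :
    P.real s ≤ P.real t :=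
  ENNReal.toReal_mono (measure_ne_top _ _) (measure_mono_ae h)

lemma measureReal_lt_le_of_integral_le {Ω : Type*} [MeasurableSpace Ω] {P : Measure Ω}
    [IsProbabilityMeasure P] {Y : Ω → ℝ} (hY : Integrable Y P) (hY0 : ∀ ω, 0 ≤ Y ω) {q s : ℝ}
    (hs : 0 < s) (hq : ∫ ω, Y ω ∂P ≤ q) : P.real {ω | s < Y ω} ≤ q / s := by
  rw [le_div_iff₀' hs]
  calc s * P.real {ω | s < Y ω} ≤ s * P.real {ω | s ≤ Y ω} := by
        refine mul_le_mul_of_nonneg_left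
          (measureReal_le_of_ae_imp (ae_of_all _ fun ω h => ?_)) hs.le
        simp only [Set.mem_ofPred_eq] at h ⊢
        exact h.le
    _ ≤ _ := mul_meas_ge_le_integral_of_nonneg (ae_of_all _ hY0) hY s
    _ ≤ q := hq

/-- Exponential weight bounding the indicator that the conductance of `v` is below `μd/2`. -/
def lowWeight (G : SimpleGraph V) [DecidableRel G.Adj] (β d : ℝ) (v : V)
    (u : Sym2 V → ℝ) : ℝ :=
  Real.exp (-(1 / 8) * (vertCond G (fun e => Real.exp (-β * u e)) v - muBeta β * d / 2))

/-- Exponential weight bounding the indicator that the conductance of `v` is above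
`(K + 1/2)μd`. -/
def highWeight (G : SimpleGraph V) [DecidableRel G.Adj] (β d K : ℝ) (v : V)
    (u : Sym2 V → ℝ) : ℝ :=
  Real.exp (1 / (8 * K) * (vertCond G (fun e => Real.exp (-β * u e)) v -
        (K + 1 / 2) * (muBeta β * d)))

lemma card_compl_filter_le {p : V → Prop} [DecidablePred p] {δ : ℝ}
    (h : ((Finset.univ.filter p).card : ℝ) ≥ (1 - δ) * (Fintype.card V : ℝ)) :
    ((Finset.univ.filter fun v => ¬ p v).card : ℝ) ≤ δ * Fintype.card V := by
  have := Finset.card_filter_add_card_filter_not (s := (Finset.univ : Finset V)) p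
  rw [Finset.card_univ] at this
  have h2 : ((Finset.univ.filter p).card : ℝ) + ((Finset.univ.filter fun v => ¬ p v).card : ℝ)
    = Fintype.card V := by exact_mod_cast this
  linarith

lemma le_card_filter_of_card_compl_le {p : V → Prop} [DecidablePred p] {δ : ℝ}
    (h : ((Finset.univ.filter fun v => ¬ p v).card : ℝ) ≤ δ * Fintype.card V) :
    ((Finset.univ.filter p).card : ℝ) ≥ (1 - δ) * (Fintype.card V : ℝ) := by
  have := Finset.card_filter_add_card_filter_not (s := (Finset.univ : Finset V)) p
  rw [Finset.card_univ] at this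
  have h2 : ((Finset.univ.filter p).card : ℝ) + ((Finset.univ.filter fun v => ¬ p v).card : ℝ)
    = Fintype.card V := by exact_mod_cast this
  linarith

lemma vertCond_nonneg (G : SimpleGraph V) [DecidableRel G.Adj] {c : Sym2 V → ℝ}
    (hc : ∀ e, 0 ≤ c e) (v : V) : 0 ≤ vertCond G c v :=
  Finset.sum_nonneg fun _ _ => hc _

lemma one_le_lowWeight (G : SimpleGraph V) [DecidableRel G.Adj] {β d : ℝ} {v : V}
    {u : Sym2 V → ℝ}
    (h : vertCond G (fun e => Real.exp (-β * u e)) v < muBeta β * d / 2) :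
    1 ≤ lowWeight G β d v u :=
  Real.one_le_exp (by linarith)

/-- A filtered sum of a function bounded by `f` off `B` and by `g` on `B`. -/
lemma sum_filter_le_add {p q : V → Prop} [DecidablePred p] [DecidablePred q] {x f g : V → ℝ}
    (hf : ∀ v, 0 ≤ f v) (hg : ∀ v, 0 ≤ g v) (hxf : ∀ v, p v → q v → x v ≤ f v)
    (hxg : ∀ v, p v → ¬ q v → x v ≤ g v) :
    ∑ v ∈ Finset.univ.filter p, x v ≤
      (∑ v ∈ Finset.univ.filter q, f v) + ∑ v ∈ Finset.univ.filter (fun v => ¬ q v), g v := by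
  rw [Finset.sum_filter, Finset.sum_filter, Finset.sum_filter, ← Finset.sum_add_distrib]
  refine Finset.sum_le_sum fun v _ => ?_
  by_cases hp : p v <;> by_cases hq : q v <;> simp [hp, hq, hf, hg]
  · exact hxf v hp hq
  · exact hxg v hp hq

lemma exp_neg_mul_le_one {β x : ℝ} (hβ : 0 ≤ β) (hx : x ∈ Set.Icc (0:ℝ) 1) :
    Real.exp (-β * x) ≤ 1 :=
  Real.exp_le_one_iff.2 (by nlinarith [hx.1])

lemma eoCondAt_of_isEmpty [IsEmpty V] (G : SimpleGraph V) [DecidableRel G.Adj]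
    (c : Sym2 V → ℝ) (γ δ : ℝ) : EOCondAt G c γ δ := by
  refine ⟨by simp, fun e => ?_⟩
  exact isEmptyElim e

lemma llCondAt_of_isEmpty [IsEmpty V] (G : SimpleGraph V) [DecidableRel G.Adj]
    (c : Sym2 V → ℝ) (γ K δ : ℝ) : LLCondAt G c γ K δ := by
  refine ⟨by simp, by simp, fun e => ?_⟩
  exact isEmptyElim e

lemma measureReal_not_eoCondAt_le (G : SimpleGraph V) [DecidableRel G.Adj] {β d δ : ℝ}
    (hβ : 0 ≤ β) (hδ : 0 < δ) (hx : 1 ≤ δ * (muBeta β * d))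
    (h : ((Finset.univ.filter fun v : V => d ≤ (G.degree v : ℝ)).card : ℝ)
        ≥ (1 - δ) * (Fintype.card V : ℝ)) :
    (labelMeasure (Sym2 V)).real {u | ¬ EOCondAt G (fun e => Real.exp (-β * u e))
        (muBeta β * d / 2) (2 * δ)} ≤ Real.exp (-(muBeta β * d) / 32) / δ := by
  rcases isEmpty_or_nonempty V with hV | hV
  · simp only [eoCondAt_of_isEmpty, not_true_eq_false, Set.ofPred_false, measureReal_empty]
    positivity
  have hN : (0:ℝ) < Fintype.card V := by exact_mod_cast Fintype.card_pos
  set Y : (Sym2 V → ℝ) → ℝ := fun u =>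
    ∑ v ∈ Finset.univ.filter (fun v : V => d ≤ (G.degree v : ℝ)), lowWeight G β d v u with hYdef
  have hWint : ∀ v, Integrable (lowWeight G β d v) (labelMeasure (Sym2 V)) := fun v =>
    integrable_exp_mul_vertCond G v β _ _
  have hYint : Integrable Y (labelMeasure (Sym2 V)) := integrable_finsetSum _ fun v _ => hWint v
  have hY0 : ∀ u, 0 ≤ Y u := fun u => Finset.sum_nonneg fun v _ => (Real.exp_pos _).le
  have hYle : ∫ u, Y u ∂labelMeasure (Sym2 V) ≤
      Fintype.card V * Real.exp (-(muBeta β * d) / 32) := by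
    rw [hYdef, integral_finsetSum _ fun v _ => hWint v]
    refine (Finset.sum_le_card_nsmul _ _ _ fun v hv => integral_lower_tail_le G hβ
      (Finset.mem_filter.1 hv).2).trans ?_
    rw [nsmul_eq_mul]
    gcongr
    exact Finset.card_le_univ _
  have hM := measureReal_lt_le_of_integral_le hYint hY0 (mul_pos hδ hN) hYle
  calc _ ≤ (labelMeasure (Sym2 V)).real {u | δ * Fintype.card V < Y u} := by
        refine measureReal_le_of_ae_imp ?_
        filter_upwards [ae_labelMeasure_mem_Icc (Sym2 V)] with u hu hE
        by_contra hY
        replace hY : Y u ≤ δ * Fintype.card V := not_lt.1 hY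
        refine hE ⟨le_card_filter_of_card_compl_le ?_, fun e _ => ?_⟩
        · rw [Finset.cast_card]
          have hcompl := card_compl_filter_le h
          rw [Finset.cast_card] at hcompl
          have := sum_filter_le_add (x := fun _ => (1:ℝ)) (f := fun v => lowWeight G β d v u)
            (g := fun _ => (1:ℝ)) (q := fun v : V => d ≤ (G.degree v : ℝ))
            (p := fun v => ¬ muBeta β * d / 2 ≤ vertCond G (fun e => Real.exp (-β * u e)) v)
            (fun v => (Real.exp_pos _).le) (fun _ => zero_le_one)
            (fun v hp _ => one_le_lowWeight G (not_le.1 hp)) (fun _ _ _ => le_rfl)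
          linarith
        · linarith [exp_neg_mul_le_one hβ (hu e)]
    _ ≤ _ := hM
    _ = _ := by field_simp

lemma vertCond_tail_le (G : SimpleGraph V) [DecidableRel G.Adj] {β d K : ℝ} {v : V}
    {u : Sym2 V → ℝ} (hK : 1 < K) (hx : 1 ≤ muBeta β * d)
    (h : vertCond G (fun e => Real.exp (-β * u e)) v ∉
      Set.Icc (muBeta β * d / 2) ((2 * K + 1) * (muBeta β * d / 2))) :
    1 ≤ lowWeight G β d v u + highWeight G β d K v u ∧
    vertCond G (fun e => Real.exp (-β * u e)) v ≤
      10 * K * (muBeta β * d) * (lowWeight G β d v u + highWeight G β d K v u) := by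
  have hA : 0 < lowWeight G β d v u := Real.exp_pos _
  have hB : 0 < highWeight G β d K v u := Real.exp_pos _
  have hKx : 1 * 1 ≤ K * (muBeta β * d) := mul_le_mul hK.le hx zero_le_one (by linarith)
  rw [Set.mem_Icc, not_and_or, not_le, not_le] at h
  rcases h with h | h
  · have h1 := one_le_lowWeight G h
    refine ⟨by linarith, ?_⟩
    have : 10 * K * (muBeta β * d) * 1 ≤
        10 * K * (muBeta β * d) * (lowWeight G β d v u + highWeight G β d K v u) := by
      apply mul_le_mul_of_nonneg_left <;> nlinarith
    nlinarith
  · set C := vertCond G (fun e => Real.exp (-β * u e)) v with hC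
    set x := muBeta β * d with hxdef
    have hexp : 1 / (8 * K) * (C - (K + 1 / 2) * x) + 1 ≤ highWeight G β d K v u :=
      Real.add_one_le_exp _
    have hpos : 0 ≤ 1 / (8 * K) * (C - (K + 1 / 2) * x) := by
      apply mul_nonneg
      · have : 0 < K := by linarith
        positivity
      · linarith
    refine ⟨by linarith, ?_⟩
    have hCle : C ≤ (K + 1 / 2) * x + 8 * K * (highWeight G β d K v u - 1) := by
      have h2 : 8 * K * (1 / (8 * K) * (C - (K + 1 / 2) * x)) = C - (K + 1 / 2) * x := by
        have : K ≠ 0 := by linarith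
        field_simp
      have h3 := mul_le_mul_of_nonneg_left hexp (show 0 ≤ 8 * K by linarith)
      rw [mul_add, h2] at h3
      linarith
    have hB1 : 1 ≤ highWeight G β d K v u := by linarith
    have e1 : 0 ≤ (K + 1 / 2) * x * (highWeight G β d K v u - 1) := by
      apply mul_nonneg <;> nlinarith
    have e2 : 0 ≤ 8 * K * (x - 1) * highWeight G β d K v u := by
      apply mul_nonneg _ hB.le
      nlinarith
    have e3 : 0 ≤ 10 * K * x * lowWeight G β d v u := by
      apply mul_nonneg _ hA.le
      nlinarith
    have e4 : 0 ≤ (K - 1 / 2) * x * highWeight G β d K v u := by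
      apply mul_nonneg _ hB.le
      nlinarith
    nlinarith

lemma measureReal_exceptional_vertCond_le [Nonempty V] (G : SimpleGraph V) [DecidableRel G.Adj]
    (B : Finset V) {β d δ : ℝ} (hβ : 0 ≤ β) (hx : 0 ≤ δ * (muBeta β * d))
    (hB : ∑ v ∈ B, (G.degree v : ℝ) ≤ δ * d * Fintype.card V) :
    (labelMeasure (Sym2 V)).real {u | 2 * (δ * (muBeta β * d)) * Fintype.card V <
        ∑ v ∈ B, vertCond G (fun e => Real.exp (-β * u e)) v} ≤
      Real.exp (-(δ * (muBeta β * d)) / 8) := by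
  have hN : (1:ℝ) ≤ Fintype.card V := by exact_mod_cast Fintype.card_pos
  have hM := measureReal_lt_le_of_integral_le (integrable_exp_mul_sum_vertCond G B β (1 / 4))
    (fun u => (Real.exp_pos _).le)
    (Real.exp_pos (1 / 4 * (2 * (δ * (muBeta β * d)) * Fintype.card V)))
    (integral_exp_mul_sum_vertCond_le G B hβ (by norm_num [abs_le]))
  rw [← Real.exp_sub] at hM
  calc _ ≤ _ := measureReal_le_of_ae_imp (ae_of_all _ fun u hu => by
        simp only [Set.mem_ofPred_eq, Real.exp_lt_exp] at hu ⊢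
        linarith)
    _ ≤ _ := hM
    _ ≤ _ := by
      apply Real.exp_le_exp.2
      have h1 := mul_le_mul_of_nonneg_left hB (muBeta_pos β).le
      have h2 := mul_le_mul_of_nonneg_left hN hx
      nlinarith

lemma measureReal_not_llCondAt_le (G : SimpleGraph V) [DecidableRel G.Adj] {β d δ K : ℝ}
    (hβ : 0 ≤ β) (hK : 1 < K) (hδ : 0 < δ) (hx1 : 1 ≤ muBeta β * d)
    (hx : 1 ≤ δ * (muBeta β * d)) (h : LLCondAt G (fun _ => (1:ℝ)) d K δ) :
    (labelMeasure (Sym2 V)).real {u | ¬ LLCondAt G (fun e => Real.exp (-β * u e))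
        (muBeta β * d / 2) (2 * K + 1) ((2 * K + 3) * δ)} ≤
      40 * K * (Real.exp (-(muBeta β * d) / (32 * K)) / δ) +
        Real.exp (-(δ * (muBeta β * d)) / 8) := by
  have hK0 : 0 < K := by linarith
  rcases isEmpty_or_nonempty V with hV | hV
  · simp only [llCondAt_of_isEmpty, not_true_eq_false, Set.ofPred_false, measureReal_empty]
    positivity
  have hN : (0:ℝ) < Fintype.card V := by exact_mod_cast Fintype.card_pos
  simp only [LLCondAt, vertCond_one] at h
  obtain ⟨hcard, hsum, -⟩ := h
  set q : V → Prop := fun v => (G.degree v : ℝ) ∈ Set.Icc d (K * d) with hq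
  have hcompl := card_compl_filter_le hcard
  set Y : (Sym2 V → ℝ) → ℝ := fun u =>
    ∑ v ∈ Finset.univ.filter q, (lowWeight G β d v u + highWeight G β d K v u) with hYdef
  have hWint : ∀ v, Integrable (fun u => lowWeight G β d v u + highWeight G β d K v u)
      (labelMeasure (Sym2 V)) := fun v =>
    (integrable_exp_mul_vertCond G v β _ _).add (integrable_exp_mul_vertCond G v β _ _)
  have hYint : Integrable Y (labelMeasure (Sym2 V)) := integrable_finsetSum _ fun v _ => hWint v
  have hW0 : ∀ u v, 0 ≤ lowWeight G β d v u + highWeight G β d K v u := fun u v =>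
    add_nonneg (Real.exp_pos _).le (Real.exp_pos _).le
  have hY0 : ∀ u, 0 ≤ Y u := fun u => Finset.sum_nonneg fun v _ => hW0 u v
  have hlow : Real.exp (-(muBeta β * d) / 32) ≤ Real.exp (-(muBeta β * d) / (32 * K)) := by
    apply Real.exp_le_exp.2
    rw [neg_div, neg_div, neg_le_neg_iff]
    gcongr
    linarith
  have hYle : ∫ u, Y u ∂labelMeasure (Sym2 V) ≤
      Fintype.card V * (2 * Real.exp (-(muBeta β * d) / (32 * K))) := by
    rw [hYdef, integral_finsetSum _ fun v _ => hWint v]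
    refine (Finset.sum_le_card_nsmul _ _ (2 * Real.exp (-(muBeta β * d) / (32 * K)))
      fun v hv => ?_).trans ?_
    · have hv' := (Finset.mem_filter.1 hv).2
      refine (integral_add (integrable_exp_mul_vertCond G v β _ _)
        (integrable_exp_mul_vertCond G v β _ _)).trans_le ?_
      rw [two_mul]
      exact add_le_add ((integral_lower_tail_le G hβ hv'.1).trans hlow)
        (integral_upper_tail_le G hβ hK hv'.2)
    · rw [nsmul_eq_mul]
      gcongr
      exact Finset.card_le_univ _
  have hM := measureReal_lt_le_of_integral_le hYint hY0
    (show 0 < δ * Fintype.card V / (20 * K) by positivity) hYle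
  have hS := measureReal_exceptional_vertCond_le G (Finset.univ.filter fun v => ¬ q v) hβ
    (by linarith) hsum
  calc _ ≤ (labelMeasure (Sym2 V)).real ({u | δ * Fintype.card V / (20 * K) < Y u} ∪
        {u | 2 * (δ * (muBeta β * d)) * Fintype.card V < ∑ v ∈ Finset.univ.filter (fun v => ¬ q v),
          vertCond G (fun e => Real.exp (-β * u e)) v}) := by
        refine measureReal_le_of_ae_imp ?_
        filter_upwards [ae_labelMeasure_mem_Icc (Sym2 V)] with u hu hE
        by_contra hnot
        simp only [Set.mem_union, Set.mem_ofPred_eq, not_or, not_lt] at hnot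
        obtain ⟨hY, hS'⟩ := hnot
        rw [le_div_iff₀ (by positivity)] at hY
        refine hE ⟨le_card_filter_of_card_compl_le ?_, ?_, fun e _ => ?_⟩
        · rw [Finset.cast_card]
          rw [Finset.cast_card] at hcompl
          have := sum_filter_le_add (x := fun _ => (1:ℝ))
            (f := fun v => lowWeight G β d v u + highWeight G β d K v u)
            (g := fun _ => (1:ℝ)) (q := q)
            (p := fun v => vertCond G (fun e => Real.exp (-β * u e)) v ∉
              Set.Icc (muBeta β * d / 2) ((2 * K + 1) * (muBeta β * d / 2)))
            (hW0 u) (fun _ => zero_le_one)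
            (fun v hp _ => (vertCond_tail_le G hK hx1 hp).1) (fun _ _ _ => le_rfl)
          refine this.trans ?_
          have := hY0 u
          have : 0 < δ * Fintype.card V := by positivity
          have : Y u ≤ Y u * (20 * K) := by nlinarith
          change Y u + _ ≤ _
          nlinarith
        · have := sum_filter_le_add (x := fun v => vertCond G (fun e => Real.exp (-β * u e)) v)
            (f := fun v => 10 * K * (muBeta β * d) *
              (lowWeight G β d v u + highWeight G β d K v u))
            (g := fun v => vertCond G (fun e => Real.exp (-β * u e)) v) (q := q)
            (p := fun v => vertCond G (fun e => Real.exp (-β * u e)) v ∉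
              Set.Icc (muBeta β * d / 2) ((2 * K + 1) * (muBeta β * d / 2)))
            (fun v => mul_nonneg (mul_nonneg (by linarith) (by linarith)) (hW0 u v))
            (fun v => vertCond_nonneg G (fun e => (Real.exp_pos _).le) v)
            (fun v hp _ => (vertCond_tail_le G hK hx1 hp).2) (fun _ _ _ => le_rfl)
          rw [← Finset.mul_sum] at this
          refine this.trans ?_
          change 10 * K * (muBeta β * d) * Y u + _ ≤ _
          have h1 := mul_le_mul_of_nonneg_right hY (zero_le_one.trans hx1)
          have h2 : 0 ≤ (K - 1) * (δ * (muBeta β * d) * Fintype.card V) :=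
            mul_nonneg (by linarith) (mul_nonneg (by linarith) hN.le)
          linarith
        · refine (exp_neg_mul_le_one hβ (hu e)).trans ?_
          nlinarith
    _ ≤ _ := measureReal_union_le _ _
    _ ≤ _ := add_le_add hM hS
    _ = _ := by
      congr 1
      field_simp
      ring

lemma exp_neg_div_le {a x : ℝ} (ha : 0 < a) (hx : 0 < x) :
    Real.exp (-x / a) ≤ 2 * a ^ 2 / x ^ 2 := by
  have h := Real.quadratic_le_exp_of_nonneg (div_pos hx ha).le
  have h2 : (x / a) ^ 2 / 2 ≤ Real.exp (x / a) := by linarith [div_pos hx ha]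
  rw [neg_div, Real.exp_neg]
  calc (Real.exp (x / a))⁻¹ ≤ ((x / a) ^ 2 / 2)⁻¹ := by gcongr
    _ = _ := by field_simp

lemma exp_neg_div_div_le {a x δ κ : ℝ} (ha : 0 < a) (hδ : 0 < δ) (hδ1 : δ ≤ 1) (hκ : 0 < κ)
    (hx : κ ≤ x * δ ^ 2) : Real.exp (-x / a) / δ ≤ 2 * a ^ 2 / κ ^ 2 * δ ^ 2 := by
  have hx0 : 0 < x := pos_of_mul_pos_left (hκ.trans_le hx) (sq_nonneg δ)
  calc Real.exp (-x / a) / δ ≤ 2 * a ^ 2 / x ^ 2 / δ := by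
        gcongr
        exact exp_neg_div_le ha hx0
    _ = 2 * a ^ 2 / (x * δ ^ 2) ^ 2 * δ ^ 3 := by field_simp
    _ ≤ 2 * a ^ 2 / κ ^ 2 * δ ^ 3 := by gcongr
    _ ≤ _ := by
      refine mul_le_mul_of_nonneg_left ?_ (by positivity)
      exact pow_le_pow_of_le_one hδ.le hδ1 (by norm_num)

lemma exp_neg_mul_div_le {a x δ κ : ℝ} (ha : 0 < a) (hδ : 0 < δ) (hκ : 0 < κ)
    (hx : κ ≤ x * δ ^ 2) : Real.exp (-(δ * x) / a) ≤ 2 * a ^ 2 / κ ^ 2 * δ ^ 2 := by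
  have hx0 : 0 < x := pos_of_mul_pos_left (hκ.trans_le hx) (sq_nonneg δ)
  calc Real.exp (-(δ * x) / a) ≤ 2 * a ^ 2 / (δ * x) ^ 2 := exp_neg_div_le ha (by positivity)
    _ = 2 * a ^ 2 / (x * δ ^ 2) ^ 2 * δ ^ 2 := by field_simp
    _ ≤ _ := by gcongr

lemma isLittleO_of_eventually_le_mul_sq {f δ : ℕ → ℝ} {C : ℝ} (hf : ∀ n, 0 ≤ f n)
    (hδ0 : Tendsto δ atTop (nhds 0)) (h : ∀ᶠ n in atTop, f n ≤ C * δ n ^ 2) :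
    f =o[atTop] δ := by
  have h1 : f =O[atTop] fun n => δ n * δ n := by
    refine Asymptotics.IsBigO.of_bound C ?_
    filter_upwards [h] with n hn
    rw [Real.norm_of_nonneg (hf n), Real.norm_of_nonneg (mul_self_nonneg _), ← sq]
    exact hn
  refine h1.trans_isLittleO ?_
  simpa using ((Asymptotics.isLittleO_one_iff ℝ).2 hδ0).mul_isBigO
    (Asymptotics.isBigO_refl δ atTop)

lemma exists_eventually_le_muBeta_mul {d β δt : ℕ → ℝ} (hd : Tendsto d atTop atTop)
    (hδlb : (fun n => Real.sqrt (max (β n) 1 / d n)) =O[atTop] δt) :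
    ∃ κ > 0, ∀ᶠ n in atTop, κ ≤ muBeta (β n) * d n * δt n ^ 2 := by
  obtain ⟨C, hC, hb⟩ := hδlb.exists_pos
  refine ⟨Real.exp (-1) / C ^ 2, by positivity, ?_⟩
  filter_upwards [hb.bound, hd.eventually_gt_atTop 0] with n hn hdn
  have hm : 0 < max (β n) 1 := lt_max_of_lt_right one_pos
  rw [Real.norm_of_nonneg (Real.sqrt_nonneg _)] at hn
  have hsq : max (β n) 1 / d n ≤ C ^ 2 * δt n ^ 2 := by
    calc max (β n) 1 / d n = Real.sqrt (max (β n) 1 / d n) ^ 2 :=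
          (Real.sq_sqrt (by positivity)).symm
      _ ≤ (C * ‖δt n‖) ^ 2 := by gcongr
      _ = _ := by rw [mul_pow, Real.norm_eq_abs, sq_abs]
  rw [div_le_iff₀ hdn] at hsq
  rw [div_le_iff₀ (by positivity)]
  calc Real.exp (-1) ≤ muBeta (β n) * max (β n) 1 := exp_neg_one_le_muBeta_mul
    _ ≤ muBeta (β n) * (C ^ 2 * δt n ^ 2 * d n) := by
      gcongr
      exact (muBeta_pos _).le
    _ = _ := by ring

/-- Let `Gₙ` be graphs, `dₙ ≫ 1`, `βₙ ≪ dₙ`, and `δ̃ₙ` with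
`(max(βₙ,1)/dₙ)^{1/2} ≤ O(δ̃ₙ) ≪ 1`; let `c_{βₙ}(e) = exp(-βₙ U_e)` with i.i.d. Uniform[0,1]
labels, and `μₙ = E[e^{-βₙ U}] = (1-e^{-βₙ})/βₙ`.
(a) If at least `(1-δ̃ₙ)|V(Gₙ)|` vertices have degree `≥ dₙ`, then with probability
`1 - o(δ̃ₙ)` the random network `(Gₙ, c_{βₙ})` satisfies (the conditions of)
Assumption (EO) with `γₙ = μₙdₙ/2` and `δₙ = 2δ̃ₙ`.
(b) If `(Gₙ, 1)` satisfies Assumption (LL) with parameters `K̃`, `γₙ = dₙ`, `δ̃ₙ`, then with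
probability `1 - o(δ̃ₙ)` the network `(Gₙ, c_{βₙ})` satisfies (the conditions of)
Assumption (LL) with `γₙ = μₙdₙ/2`, `K = 2K̃+1`, `δₙ = (2K̃+3)δ̃ₙ`. -/
theorem random_conductances_balanced
    (V : ℕ → Type) [∀ n, Fintype (V n)] [∀ n, DecidableEq (V n)]
    (G : ∀ n, SimpleGraph (V n)) [∀ n, DecidableRel (G n).Adj]
    (d : ℕ → ℝ) (β : ℕ → ℝ) (δt : ℕ → ℝ) (Kt : ℝ)
    (hKt : 1 < Kt)
    (hβ0 : ∀ n, 0 ≤ β n)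
    (hd : Tendsto d atTop atTop)
    (hβd : Tendsto (fun n => β n / d n) atTop (nhds 0))
    (hδpos : ∀ n, 0 < δt n)
    (hδ0 : Tendsto δt atTop (nhds 0))
    (hδlb : (fun n => Real.sqrt (max (β n) 1 / d n)) =O[atTop] δt) :
    -- (a)
    ((∀ n, (((Finset.univ.filter fun v : V n => d n ≤ ((G n).degree v : ℝ)).card : ℝ))
        ≥ (1 - δt n) * (Fintype.card (V n) : ℝ)) →
      (fun n => ((labelMeasure (Sym2 (V n)))
          {u | ¬ EOCondAt (G n) (fun e => Real.exp (-β n * u e))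
                (muBeta (β n) * d n / 2) (2 * δt n)}).toReal)
        =o[atTop] δt) ∧
    -- (b)
    ((∀ᶠ n in atTop, LLCondAt (G n) (fun _ => (1:ℝ)) (d n) Kt (δt n)) →
      (fun n => ((labelMeasure (Sym2 (V n)))
          {u | ¬ LLCondAt (G n) (fun e => Real.exp (-β n * u e))
                (muBeta (β n) * d n / 2) (2 * Kt + 1) ((2 * Kt + 3) * δt n)}).toReal)
        =o[atTop] δt) := by
  obtain ⟨κ, hκ, hev⟩ := exists_eventually_le_muBeta_mul hd hδlb
  have hδsmall : ∀ᶠ n in atTop, δt n ≤ min κ 1 :=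
    (hδ0.eventually_lt_const (lt_min hκ one_pos)).mono fun n hn => hn.le
  have hscale : ∀ᶠ n in atTop, δt n ≤ 1 ∧ κ ≤ muBeta (β n) * d n * δt n ^ 2 ∧
      1 ≤ δt n * (muBeta (β n) * d n) ∧ 1 ≤ muBeta (β n) * d n := by
    filter_upwards [hev, hδsmall] with n hn hδn
    have hpos := hδpos n
    have hδκ := hδn.trans (min_le_left _ _)
    have hδ1 := hδn.trans (min_le_right _ _)
    have hx : 1 ≤ δt n * (muBeta (β n) * d n) := by
      by_contra! hlt
      nlinarith
    refine ⟨hδ1, hn, hx, ?_⟩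
    by_contra! hlt
    nlinarith
  constructor
  · intro h
    refine isLittleO_of_eventually_le_mul_sq (C := 2 * 32 ^ 2 / κ ^ 2)
      (fun n => ENNReal.toReal_nonneg) hδ0 ?_
    filter_upwards [hscale] with n ⟨hδ1, hn, hx, _⟩
    exact (measureReal_not_eoCondAt_le (G n) (hβ0 n) (hδpos n) hx (h n)).trans
      (exp_neg_div_div_le (by norm_num) (hδpos n) hδ1 hκ hn)
  · intro h
    refine isLittleO_of_eventually_le_mul_sq
      (C := 40 * Kt * (2 * (32 * Kt) ^ 2 / κ ^ 2) + 2 * 8 ^ 2 / κ ^ 2)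
      (fun n => ENNReal.toReal_nonneg) hδ0 ?_
    filter_upwards [hscale, h] with n ⟨hδ1, hn, hx, hx1⟩ hLL
    refine (measureReal_not_llCondAt_le (G n) (hβ0 n) hKt (hδpos n) hx1 hx hLL).trans ?_
    rw [add_mul, mul_assoc (40 * Kt)]
    exact add_le_add (mul_le_mul_of_nonneg_left
      (exp_neg_div_div_le (by linarith) (hδpos n) hδ1 hκ hn) (by linarith))
      (exp_neg_mul_div_le (by norm_num) (hδpos n) hκ hn)

end WSTPaper
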